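/- Let ρ, σ, ω be densities on ℂ^d with σ positive definite, and let ζ ∈ (0,1) and c ≥ 1 satisfy (1−ζ)σ ≤ ω ≤ (1 + ζ(c−1))σ in the Loewner order. Set η := (ω − (1−ζ)σ)/ζ (a density). Then (1−ζ)² · D(ρ‖σ) ≤ (1 + ζ(c+1) + 2ζ²(c−1)) · D(ρ‖ω) + 3ζ(2+ζ) · (1 + (c−1)²/(c(ln c − 1) + 1)) · D(η‖σ), where by convention the fraction (c−1)²/(c(ln c − 1) + 1) is interpreted as 0 when c = 1 (consistent with the convention 0/0 = 0). -/

import Mathlib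

open Matrix
open scoped ComplexOrder

/-- Matrix logarithm of a Hermitian matrix via functional calculus
(junk value `0` for non-Hermitian input). -/
noncomputable def matLog {d : ℕ} (A : Matrix (Fin d) (Fin d) ℂ) : Matrix (Fin d) (Fin d) ℂ :=
  if hA : A.IsHermitian then hA.cfc Real.log else 0

/-- Umegaki relative entropy `D(ρ‖σ) = Re tr (ρ (log ρ - log σ))`. -/
noncomputable def relEnt {d : ℕ} (ρ σ : Matrix (Fin d) (Fin d) ℂ) : ℝ :=
  ((ρ * (matLog ρ - matLog σ)).trace).re

/-- A density matrix: positive semidefinite with trace one. -/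
def IsDensity {d : ℕ} (ρ : Matrix (Fin d) (Fin d) ℂ) : Prop :=
  ρ.PosSemidef ∧ ρ.trace = 1

/-- `ρ` majorizes `σ`: for every `k`, the maximum over `k`-element index sets of the
sum of corresponding eigenvalues of `ρ` dominates the analogous maximum for `σ`. -/
def Majorizes {d : ℕ} {ρ σ : Matrix (Fin d) (Fin d) ℂ}
    (hρ : ρ.IsHermitian) (hσ : σ.IsHermitian) : Prop :=
  ∀ k : ℕ, k ≤ d → ∀ T : Finset (Fin d), T.card = k →
    ∃ S : Finset (Fin d), S.card = k ∧ ∑ i ∈ T, hσ.eigenvalues i ≤ ∑ i ∈ S, hρ.eigenvalues i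


namespace Matrix

variable {n : Type*} [Fintype n] [DecidableEq n]

namespace IsHermitian

variable {A B : Matrix n n ℂ}

lemma cfc_eq_mul (hA : A.IsHermitian) (f : ℝ → ℝ) :
    hA.cfc f = (hA.eigenvectorUnitary : Matrix n n ℂ) *
      diagonal (fun i ↦ (f (hA.eigenvalues i) : ℂ)) *
        star (hA.eigenvectorUnitary : Matrix n n ℂ) := by
  rw [IsHermitian.cfc, Unitary.conjStarAlgAut_apply]
  rfl

lemma cfc_mul_cfc (hA : A.IsHermitian) (f g : ℝ → ℝ) :
    hA.cfc f * hA.cfc g = hA.cfc (fun x ↦ f x * g x) := by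
  simp only [IsHermitian.cfc, ← map_mul, diagonal_mul_diagonal, Function.comp_def]

lemma add_smul_one_eq_cfc (hA : A.IsHermitian) (r : ℝ) :
    A + r • 1 = hA.cfc (fun x ↦ x + r) := by
  have h1 : (r • 1 : Matrix n n ℂ) =
      Unitary.conjStarAlgAut ℂ _ hA.eigenvectorUnitary (r • 1) := by
    rw [Unitary.conjStarAlgAut_apply]
    simp
  conv_lhs => rw [hA.spectral_theorem, h1]
  rw [IsHermitian.cfc, ← map_add]
  congr 1
  ext i j
  by_cases h : i = j
  · subst h; simp
  · simp [h]

lemma cfc_one (hA : A.IsHermitian) : hA.cfc (fun _ ↦ 1) = 1 := by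
  simp [cfc_eq_mul]

lemma cfc_id (hA : A.IsHermitian) : hA.cfc (fun x ↦ x) = A := by
  conv_rhs => rw [hA.spectral_theorem]
  rfl

lemma exists_eq_mul_diagonal_mul (hA : A.IsHermitian) :
    ∃ (U : Matrix n n ℂ) (a : n → ℝ), U * star U = 1 ∧ star U * U = 1 ∧
      A = U * diagonal (fun i ↦ (a i : ℂ)) * star U :=
  ⟨hA.eigenvectorUnitary, hA.eigenvalues, by simp, by simp, by
    conv_lhs => rw [← hA.cfc_id]
    exact hA.cfc_eq_mul _⟩

lemma det_cfc (hA : A.IsHermitian) (f : ℝ → ℝ) :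
    (hA.cfc f).det = ((∏ i, f (hA.eigenvalues i) : ℝ) : ℂ) := by
  rw [cfc_eq_mul, det_mul_right_comm]
  simp

lemma isHermitian_cfc (hA : A.IsHermitian) (f : ℝ → ℝ) : (hA.cfc f).IsHermitian := by
  rw [cfc_eq_mul, IsHermitian, star_eq_conjTranspose]
  simp only [conjTranspose_mul, conjTranspose_conjTranspose, diagonal_conjTranspose, mul_assoc]
  congr 3
  ext i
  simp

/-- The squared moduli of the inner products between the eigenvectors of two Hermitian matrices. -/
noncomputable def overlap (hA : A.IsHermitian) (hB : B.IsHermitian) (i j : n) : ℝ :=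
  Complex.normSq ((star (hA.eigenvectorUnitary : Matrix n n ℂ) * hB.eigenvectorUnitary) i j)

lemma trace_cfc_mul_cfc (hA : A.IsHermitian) (hB : B.IsHermitian) (f g : ℝ → ℝ) :
    (hA.cfc f * hB.cfc g).trace =
      ((∑ i, ∑ j, hA.overlap hB i j * (f (hA.eigenvalues i) * g (hB.eigenvalues j)) : ℝ) : ℂ) := by
  set U : Matrix n n ℂ := hA.eigenvectorUnitary.1
  set V : Matrix n n ℂ := hB.eigenvectorUnitary.1
  have h : (hA.cfc f * hB.cfc g).trace =
      (diagonal (fun i ↦ (f (hA.eigenvalues i) : ℂ)) * (star U * V) *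
        diagonal (fun i ↦ (g (hB.eigenvalues i) : ℂ)) * star (star U * V)).trace := by
    rw [cfc_eq_mul, cfc_eq_mul, star_mul, star_star]
    simp only [mul_assoc]
    rw [trace_mul_comm U]
    simp only [mul_assoc]
    rfl
  rw [h, trace]
  push_cast
  refine Finset.sum_congr rfl fun i _ ↦ ?_
  rw [diag_apply, mul_apply]
  refine Finset.sum_congr rfl fun j _ ↦ ?_
  rw [mul_diagonal, diagonal_mul, star_apply, overlap, Complex.normSq_eq_conj_mul_self,
    RCLike.star_def]
  ring

lemma sum_overlap_right (hA : A.IsHermitian) (hB : B.IsHermitian) (i : n) :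
    ∑ j, hA.overlap hB i j = 1 := by
  set M : Matrix n n ℂ := star (hA.eigenvectorUnitary : Matrix n n ℂ) * hB.eigenvectorUnitary
    with hM
  have h : M * star M = 1 := by
    rw [hM, star_mul, star_star, mul_assoc, ← mul_assoc _ (star _)]
    simp
  have h2 := congrFun (congrFun h i) i
  rw [mul_apply, one_apply_eq] at h2
  apply Complex.ofReal_injective
  rw [Complex.ofReal_one, ← h2, Complex.ofReal_sum]
  refine Finset.sum_congr rfl fun j _ ↦ ?_
  rw [overlap, Complex.normSq_eq_conj_mul_self, star_apply, RCLike.star_def, mul_comm]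

lemma sum_overlap_left (hA : A.IsHermitian) (hB : B.IsHermitian) (j : n) :
    ∑ i, hA.overlap hB i j = 1 := by
  set M : Matrix n n ℂ := star (hA.eigenvectorUnitary : Matrix n n ℂ) * hB.eigenvectorUnitary
    with hM
  have h : star M * M = 1 := by
    rw [hM, star_mul, star_star, mul_assoc, ← mul_assoc _ (star _)]
    simp
  have h2 := congrFun (congrFun h j) j
  rw [mul_apply, one_apply_eq] at h2
  apply Complex.ofReal_injective
  rw [Complex.ofReal_one, ← h2, Complex.ofReal_sum]
  refine Finset.sum_congr rfl fun i _ ↦ ?_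
  rw [overlap, Complex.normSq_eq_conj_mul_self, star_apply, RCLike.star_def]

end IsHermitian

/-- The log-determinant (Stein) divergence `tr (S⁻¹ P) - n - log det (S⁻¹ P)`. -/
noncomputable def logDetDiv (P S : Matrix n n ℂ) : ℝ :=
  (S⁻¹ * P).trace.re - Fintype.card n - Real.log P.det.re + Real.log S.det.re

lemma logDetDiv_congr {T : Matrix n n ℂ} (hT : IsUnit T) {P S : Matrix n n ℂ}
    (hP : P.PosDef) (hS : S.PosDef) :
    logDetDiv (Tᴴ * P * T) (Tᴴ * S * T) = logDetDiv P S := by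
  have hTd : IsUnit T.det := (isUnit_iff_isUnit_det T).1 hT
  have hTd' : IsUnit Tᴴ.det := by rw [det_conjTranspose]; exact hTd.star
  have htr : (Tᴴ * S * T)⁻¹ * (Tᴴ * P * T) = T⁻¹ * (S⁻¹ * P * T) := by
    rw [mul_inv_rev, mul_inv_rev]
    simp only [mul_assoc]
    rw [nonsing_inv_mul_cancel_left _ _ hTd']
  have hdet (X : Matrix n n ℂ) (hX : X.PosDef) : Real.log (Tᴴ * X * T).det.re =
      Real.log (Complex.normSq T.det) + Real.log X.det.re := by
    have h0 := Complex.pos_iff.1 hX.det_pos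
    rw [← Real.log_mul (by simpa using hTd.ne_zero) h0.1.ne', det_mul, det_mul,
      det_conjTranspose, mul_right_comm, RCLike.star_def, ← Complex.normSq_eq_conj_mul_self,
      Complex.re_ofReal_mul]
  rw [logDetDiv, logDetDiv, htr, hdet P hP, hdet S hS, trace_mul_comm, mul_assoc,
    mul_nonsing_inv _ hTd, mul_one]
  ring

/-- Simultaneous diagonalization by congruence of a positive definite and a Hermitian matrix. -/
lemma PosDef.exists_congr_diagonal {S H : Matrix n n ℂ} (hS : S.PosDef) (hH : H.IsHermitian) :
    ∃ (T : Matrix n n ℂ) (ν : n → ℝ), IsUnit T ∧ S = Tᴴ * T ∧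
      H = Tᴴ * diagonal (fun i ↦ (ν i : ℂ)) * T := by
  set B := hS.1.cfc Real.sqrt with hB
  have hBB : B * B = S := by
    rw [hB, IsHermitian.cfc_mul_cfc]
    conv_rhs => rw [← hS.1.cfc_id]
    rw [IsHermitian.cfc_eq_mul, IsHermitian.cfc_eq_mul]
    simp only [Real.mul_self_sqrt (hS.eigenvalues_pos _).le]
  have hBh : Bᴴ = B := hS.1.isHermitian_cfc _
  have hBd : IsUnit B.det := by
    rw [isUnit_iff_ne_zero]
    intro h
    have := hS.det_pos.ne'
    rw [← hBB, det_mul, h, zero_mul] at this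
    exact this rfl
  have hG : (B⁻¹ * H * B⁻¹).IsHermitian := by
    rw [IsHermitian, conjTranspose_mul, conjTranspose_mul, conjTranspose_nonsing_inv, hBh, hH.eq,
      mul_assoc]
  obtain ⟨U, a, hUU, hUU', hGU⟩ := hG.exists_eq_mul_diagonal_mul
  refine ⟨star U * B, a, ?_, ?_, ?_⟩
  · have h1 : IsUnit (star U) := by
      rw [isUnit_iff_exists_inv]
      exact ⟨U, hUU'⟩
    exact h1.mul ((isUnit_iff_isUnit_det B).2 hBd)
  · rw [conjTranspose_mul, star_eq_conjTranspose, conjTranspose_conjTranspose, hBh, mul_assoc,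
      ← mul_assoc U, ← star_eq_conjTranspose, hUU, one_mul, hBB]
  · rw [conjTranspose_mul, star_eq_conjTranspose, conjTranspose_conjTranspose, hBh,
      ← star_eq_conjTranspose]
    calc H = B * (B⁻¹ * H * B⁻¹) * B := by
          rw [mul_assoc B⁻¹, mul_nonsing_inv_cancel_left _ _ hBd, nonsing_inv_mul_cancel_right _ _ hBd]
      _ = _ := by
          rw [hGU]
          simp only [mul_assoc]

/-- `log det X ≤ tr X - n` for positive definite `X`. -/
lemma PosDef.log_det_le {X : Matrix n n ℂ} (hX : X.PosDef) :
    Real.log X.det.re ≤ X.trace.re - Fintype.card n := by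
  have h1 : X.det.re = ∏ i, hX.1.eigenvalues i := by
    rw [hX.1.det_eq_prod_eigenvalues, ← RCLike.ofReal_prod]
    exact Complex.ofReal_re _
  have h2 : X.trace.re = ∑ i, hX.1.eigenvalues i := by
    rw [hX.1.trace_eq_sum_eigenvalues, ← RCLike.ofReal_sum]
    exact Complex.ofReal_re _
  rw [h1, h2, Real.log_prod fun i _ ↦ (hX.eigenvalues_pos i).ne']
  have : (Fintype.card n : ℝ) = ∑ _i : n, (1 : ℝ) := by simp
  rw [this, ← Finset.sum_sub_distrib]
  exact Finset.sum_le_sum fun i _ ↦ Real.log_le_sub_one_of_pos (hX.eigenvalues_pos i)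

/-- A weighted form of Hadamard's inequality. -/
lemma PosDef.log_det_add_sum_log_le {X : Matrix n n ℂ} (hX : X.PosDef) {q : n → ℝ}
    (hq : ∀ i, 0 < q i) :
    Real.log X.det.re + ∑ i, Real.log (q i) ≤ ∑ i, q i * (X i i).re - Fintype.card n := by
  set E : Matrix n n ℂ := diagonal (fun i ↦ (Real.sqrt (q i) : ℂ)) with hE
  have hEh : Eᴴ = E := by
    rw [hE, diagonal_conjTranspose]
    congr 1
    ext i
    simp
  have hEd : E.det = ((∏ i, Real.sqrt (q i) : ℝ) : ℂ) := by simp [hE]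
  have hEu : IsUnit E := by
    rw [isUnit_iff_isUnit_det, isUnit_iff_ne_zero, hEd]
    exact_mod_cast (Finset.prod_pos fun i _ ↦ Real.sqrt_pos.2 (hq i)).ne'
  have hY : (star E * X * E).PosDef := (IsUnit.posDef_star_left_conjugate_iff hEu).2 hX
  have hle := hY.log_det_le
  have hdet : (star E * X * E).det.re = (∏ i, q i) * X.det.re := by
    rw [star_eq_conjTranspose, hEh, det_mul, det_mul, hEd, mul_right_comm, ← Complex.ofReal_mul,
      ← Finset.prod_mul_distrib]
    simp only [Real.mul_self_sqrt (hq _).le, Complex.re_ofReal_mul]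
  have htr : (star E * X * E).trace.re = ∑ i, q i * (X i i).re := by
    rw [star_eq_conjTranspose, hEh, trace, Complex.re_sum]
    refine Finset.sum_congr rfl fun i _ ↦ ?_
    rw [diag_apply, hE, mul_diagonal, diagonal_mul, mul_right_comm, ← Complex.ofReal_mul,
      Real.mul_self_sqrt (hq _).le, Complex.re_ofReal_mul]
  have h0 := (Complex.pos_iff.1 hX.det_pos).1
  rw [hdet, htr, Real.log_mul (Finset.prod_pos fun i _ ↦ hq i).ne' h0.ne',
    Real.log_prod fun i _ ↦ (hq i).ne'] at hle
  linarith

lemma logDetDiv_diagonal (P : Matrix n n ℂ) {μ : n → ℝ} (hμ : ∀ i, 0 < μ i) :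
    logDetDiv P (diagonal fun i ↦ (μ i : ℂ)) =
      ∑ i, (μ i)⁻¹ * (P i i).re - Fintype.card n - Real.log P.det.re + ∑ i, Real.log (μ i) := by
  have hinv : (diagonal fun i ↦ (μ i : ℂ))⁻¹ = diagonal fun i ↦ (((μ i)⁻¹ : ℝ) : ℂ) := by
    apply inv_eq_right_inv
    rw [diagonal_mul_diagonal, ← diagonal_one]
    congr 1
    ext i
    rw [← Complex.ofReal_mul, mul_inv_cancel₀ (hμ i).ne', Complex.ofReal_one]
  have hdet : (diagonal fun i ↦ (μ i : ℂ)).det = ((∏ i, μ i : ℝ) : ℂ) := by simp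
  rw [logDetDiv, hinv, hdet, Complex.ofReal_re, Real.log_prod fun i _ ↦ (hμ i).ne', trace,
    Complex.re_sum]
  simp only [diag_apply, diagonal_mul, Complex.re_ofReal_mul]

lemma logDetDiv_nonneg {P S : Matrix n n ℂ} (hP : P.PosDef) (hS : S.PosDef) :
    0 ≤ logDetDiv P S := by
  obtain ⟨T, ν, hT, rfl, rfl⟩ := hS.exists_congr_diagonal hP.1
  have hD := (IsUnit.posDef_star_left_conjugate_iff hT).1 hP
  have := logDetDiv_congr hT hD PosDef.one
  rw [mul_one] at this
  rw [this, logDetDiv]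
  simpa using hD.log_det_le

lemma logDetDiv_le_of_forall_scalar {P S H : Matrix n n ℂ} (hP : P.PosDef) (hS : S.PosDef)
    (hH : H.PosDef) {ζ c K C : ℝ} (hc : (c • S - H).PosSemidef) (hK : 1 < K)
    (hμ : ∀ ν, 0 < ν → ν ≤ c → 0 < 1 - ζ + ζ * ν ∧ 1 - ζ + ζ * ν < K)
    (hscal : ∀ ν, 0 < ν → ν ≤ c →
      0 ≤ (K - 1) * Real.log ((K / (1 - ζ + ζ * ν) - 1) / (K - 1)) +
        K * Real.log (1 - ζ + ζ * ν) + C * (ν - 1 - Real.log ν)) :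
    logDetDiv P S ≤ K * logDetDiv P ((1 - ζ) • S + ζ • H) + C * logDetDiv H S := by
  obtain ⟨T, ν, hT, hST, hHT⟩ := hS.exists_congr_diagonal hH.1
  have hTi : T * T⁻¹ = 1 := mul_nonsing_inv _ ((isUnit_iff_isUnit_det T).1 hT)
  have hTi' : T⁻¹ * T = 1 := nonsing_inv_mul _ ((isUnit_iff_isUnit_det T).1 hT)
  have hTs : Tᴴ * T⁻¹ᴴ = 1 := by rw [← conjTranspose_mul, hTi', conjTranspose_one]
  set P' := T⁻¹ᴴ * P * T⁻¹ with hP'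
  have hPT : P = Tᴴ * P' * T := by
    rw [hP']
    simp only [mul_assoc]
    rw [hTi', mul_one, ← mul_assoc, hTs, one_mul]
  have hP'pd : P'.PosDef := by
    rw [hPT] at hP
    exact (IsUnit.posDef_star_left_conjugate_iff hT).1 hP
  have hνpd : (diagonal fun i ↦ (ν i : ℂ)).PosDef := by
    rw [hHT] at hH
    exact (IsUnit.posDef_star_left_conjugate_iff hT).1 hH
  have hν0 (i : n) : 0 < ν i := by
    have := posDef_diagonal_iff.1 hνpd i
    exact_mod_cast this
  have hνc (i : n) : ν i ≤ c := by
    have h : c • S - H = star T * diagonal (fun i ↦ ((c - ν i : ℝ) : ℂ)) * T := by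
      have : diagonal (fun i ↦ ((c - ν i : ℝ) : ℂ)) =
          c • (1 : Matrix n n ℂ) - diagonal (fun i ↦ (ν i : ℂ)) := by
        ext i j
        by_cases hij : i = j
        · subst hij; simp
        · simp [hij]
      rw [this, hHT, hST, star_eq_conjTranspose]
      simp [mul_sub, sub_mul]
    rw [h, IsUnit.posSemidef_star_left_conjugate_iff hT, posSemidef_diagonal_iff] at hc
    have := hc i
    rw [Complex.zero_le_real] at this
    linarith
  set μ : n → ℝ := fun i ↦ 1 - ζ + ζ * ν i
  have hμ0 (i : n) : 0 < μ i := (hμ _ (hν0 i) (hνc i)).1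
  have hμK (i : n) : μ i < K := (hμ _ (hν0 i) (hνc i)).2
  have hWT : (1 - ζ) • S + ζ • H = Tᴴ * diagonal (fun i ↦ (μ i : ℂ)) * T := by
    have : diagonal (fun i ↦ (μ i : ℂ)) =
        (1 - ζ) • (1 : Matrix n n ℂ) + ζ • diagonal (fun i ↦ (ν i : ℂ)) := by
      ext i j
      by_cases hij : i = j
      · subst hij; simp [μ]
      · simp [hij]
    rw [this, hHT, hST]
    simp [mul_add, add_mul]
  have hμpd : (diagonal fun i ↦ (μ i : ℂ)).PosDef :=
    posDef_diagonal_iff.2 fun i ↦ by exact_mod_cast hμ0 i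
  have hST' : S = Tᴴ * diagonal (fun _ ↦ ((1 : ℝ) : ℂ)) * T := by
    rw [hST]; simp
  have h1pd : (diagonal fun _ : n ↦ ((1 : ℝ) : ℂ)).PosDef :=
    posDef_diagonal_iff.2 fun i ↦ by simp
  rw [hWT, hPT, hHT, hST', logDetDiv_congr hT hP'pd h1pd, logDetDiv_congr hT hP'pd hμpd,
    logDetDiv_congr hT hνpd h1pd, logDetDiv_diagonal _ hμ0, logDetDiv_diagonal _ fun _ ↦ one_pos,
    logDetDiv_diagonal _ fun _ ↦ one_pos]
  have hdet : (diagonal fun i ↦ (ν i : ℂ)).det = ((∏ i, ν i : ℝ) : ℂ) := by simp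
  rw [hdet, Complex.ofReal_re, Real.log_prod fun i _ ↦ (hν0 i).ne']
  set q : n → ℝ := fun i ↦ (K / μ i - 1) / (K - 1)
  have hq (i : n) : 0 < q i :=
    div_pos (sub_pos.2 ((one_lt_div (hμ0 i)).2 (hμK i))) (sub_pos.2 hK)
  have hHad := mul_le_mul_of_nonneg_left (hP'pd.log_det_add_sum_log_le hq) (sub_pos.2 hK).le
  have hsum : 0 ≤ ∑ i, ((K - 1) * Real.log (q i) + K * Real.log (μ i) +
      C * (ν i - 1 - Real.log (ν i))) :=
    Finset.sum_nonneg fun i _ ↦ hscal _ (hν0 i) (hνc i)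
  have hqP : (K - 1) * ∑ i, q i * (P' i i).re =
      K * ∑ i, (μ i)⁻¹ * (P' i i).re - ∑ i, (P' i i).re := by
    rw [Finset.mul_sum, Finset.mul_sum, ← Finset.sum_sub_distrib]
    refine Finset.sum_congr rfl fun i _ ↦ ?_
    have h1 := (hμ0 i).ne'
    have h2 := (sub_pos.2 hK).ne'
    simp only [q]
    field_simp
  simp only [Finset.sum_add_distrib, ← Finset.mul_sum, Finset.sum_sub_distrib, Finset.sum_const,
    Finset.card_univ, nsmul_eq_mul, mul_one] at hsum
  simp only [inv_one, one_mul, Real.log_one, Finset.sum_const_zero, diagonal_apply_eq,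
    Complex.ofReal_re]
  rw [mul_sub, hqP] at hHad
  linarith

end Matrix

section relEnt

variable {d : ℕ} {ρ σ : Matrix (Fin d) (Fin d) ℂ}

/-- The spectral expression for `D(ρ + r ‖ σ + r)`. -/
noncomputable def shiftedRelEnt (hρ : ρ.IsHermitian) (hσ : σ.IsHermitian) (r : ℝ) : ℝ :=
  ∑ i, ∑ j, hρ.overlap hσ i j * ((hρ.eigenvalues i + r) *
    (Real.log (hρ.eigenvalues i + r) - Real.log (hσ.eigenvalues j + r)))

lemma shiftedRelEnt_zero (hρ : ρ.IsHermitian) (hσ : σ.IsHermitian) :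
    shiftedRelEnt hρ hσ 0 = relEnt ρ σ := by
  have h1 : ρ * matLog ρ = hρ.cfc (fun x ↦ x * Real.log x) * hσ.cfc (fun _ ↦ 1) := by
    have h := hρ.cfc_mul_cfc (fun x ↦ x) Real.log
    rw [hρ.cfc_id] at h
    rw [hσ.cfc_one, mul_one, matLog, dif_pos hρ, h]
  have h2 : ρ * matLog σ = hρ.cfc (fun x ↦ x) * hσ.cfc Real.log := by
    rw [hρ.cfc_id, matLog, dif_pos hσ]
  rw [relEnt, mul_sub, h1, h2, trace_sub, Matrix.IsHermitian.trace_cfc_mul_cfc,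
    Matrix.IsHermitian.trace_cfc_mul_cfc, Complex.sub_re, Complex.ofReal_re, Complex.ofReal_re,
    shiftedRelEnt, ← Finset.sum_sub_distrib]
  refine Finset.sum_congr rfl fun i _ ↦ ?_
  rw [← Finset.sum_sub_distrib]
  refine Finset.sum_congr rfl fun j _ ↦ ?_
  simp only [add_zero]
  ring

lemma continuousOn_shiftedRelEnt (hρ : ρ.IsHermitian) (hσ : σ.PosDef) :
    ContinuousOn (shiftedRelEnt hρ hσ.1) (Set.Ici 0) := by
  refine continuousOn_finsetSum _ fun i _ ↦ continuousOn_finsetSum _ fun j _ ↦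
    continuousOn_const.mul ?_
  simp only [mul_sub]
  refine ContinuousOn.sub ?_ ?_
  · exact (Real.continuous_mul_log.comp (continuous_const.add continuous_id)).continuousOn
  · refine (by fun_prop : Continuous fun r : ℝ ↦ hρ.eigenvalues i + r).continuousOn.mul
      (ContinuousOn.log (by fun_prop) fun r hr ↦ ?_)
    have := hσ.eigenvalues_pos j
    have : 0 ≤ r := hr
    positivity

lemma sum_overlap_mul_sub (hρ : ρ.IsHermitian) (hσ : σ.IsHermitian) (f g : ℝ → ℝ) :
    ∑ i, ∑ j, hρ.overlap hσ i j * (f (hρ.eigenvalues i) - g (hσ.eigenvalues j)) =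
      ∑ i, f (hρ.eigenvalues i) - ∑ j, g (hσ.eigenvalues j) := by
  simp only [mul_sub, Finset.sum_sub_distrib]
  congr 1
  · exact Finset.sum_congr rfl fun i _ ↦ by rw [← Finset.sum_mul, hρ.sum_overlap_right, one_mul]
  · rw [Finset.sum_comm]
    exact Finset.sum_congr rfl fun j _ ↦ by rw [← Finset.sum_mul, hρ.sum_overlap_left, one_mul]

lemma re_trace_eq_sum_eigenvalues (hρ : ρ.IsHermitian) :
    ρ.trace.re = ∑ i, hρ.eigenvalues i := by
  rw [hρ.trace_eq_sum_eigenvalues, ← RCLike.ofReal_sum]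
  exact Complex.ofReal_re _

lemma tendsto_shiftedRelEnt (hρ : ρ.IsHermitian) (hσ : σ.IsHermitian) (h : ρ.trace = σ.trace) :
    Filter.Tendsto (shiftedRelEnt hρ hσ) Filter.atTop (nhds 0) := by
  have h0 : ∑ i, ∑ j, hρ.overlap hσ i j * (hρ.eigenvalues i - hσ.eigenvalues j) = 0 := by
    rw [sum_overlap_mul_sub hρ hσ (fun x ↦ x) (fun x ↦ x), ← re_trace_eq_sum_eigenvalues,
      ← re_trace_eq_sum_eigenvalues, h, sub_self]
  rw [← h0]
  refine tendsto_finsetSum _ fun i _ ↦ tendsto_finsetSum _ fun j _ ↦ Filter.Tendsto.const_mul _ ?_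
  set p := hρ.eigenvalues i
  set q := hσ.eigenvalues j
  have h1 : Filter.Tendsto (fun r : ℝ ↦ q + r) Filter.atTop Filter.atTop :=
    Filter.tendsto_atTop_add_const_left _ _ Filter.tendsto_id
  have h1p : Filter.Tendsto (fun r : ℝ ↦ p + r) Filter.atTop Filter.atTop :=
    Filter.tendsto_atTop_add_const_left _ _ Filter.tendsto_id
  have h2 := ((Real.tendsto_mul_log_one_add_div_atTop (q - p)).comp h1p).neg
  rw [neg_sub] at h2
  refine h2.congr' ?_
  filter_upwards [h1.eventually_gt_atTop 0, h1p.eventually_gt_atTop 0] with r hq hp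
  have : 1 + (q - p) / (p + r) = (q + r) / (p + r) := by field_simp; ring
  simp only [Function.comp_apply]
  rw [this, Real.log_div hq.ne' hp.ne']
  ring

lemma logDetDiv_add_smul_one (hρ : ρ.PosSemidef) (hσ : σ.PosDef) {r : ℝ} (hr : 0 < r) :
    logDetDiv (ρ + r • 1) (σ + r • 1) = ∑ i, ∑ j, hρ.1.overlap hσ.1 i j *
      ((hρ.1.eigenvalues i + r) * (hσ.1.eigenvalues j + r)⁻¹ - 1 -
        Real.log (hρ.1.eigenvalues i + r) + Real.log (hσ.1.eigenvalues j + r)) := by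
  have hp (i : Fin d) : 0 < hρ.1.eigenvalues i + r :=
    add_pos_of_nonneg_of_pos (hρ.eigenvalues_nonneg i) hr
  have hq (j : Fin d) : 0 < hσ.1.eigenvalues j + r := add_pos (hσ.eigenvalues_pos j) hr
  have hinv : (σ + r • 1)⁻¹ = hσ.1.cfc (fun x ↦ (x + r)⁻¹) := by
    apply inv_eq_right_inv
    rw [hσ.1.add_smul_one_eq_cfc, hσ.1.cfc_mul_cfc, ← hσ.1.cfc_one, hσ.1.cfc_eq_mul,
      hσ.1.cfc_eq_mul]
    simp only [mul_inv_cancel₀ (hq _).ne']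
  have hlog := sum_overlap_mul_sub hρ.1 hσ.1 (fun x ↦ 1 + Real.log (x + r))
    (fun x ↦ Real.log (x + r))
  rw [logDetDiv, hinv, trace_mul_comm, hρ.1.add_smul_one_eq_cfc, hσ.1.add_smul_one_eq_cfc,
    hρ.1.trace_cfc_mul_cfc, hρ.1.det_cfc, hσ.1.det_cfc, Complex.ofReal_re, Complex.ofReal_re,
    Complex.ofReal_re, Real.log_prod fun i _ ↦ (hp i).ne', Real.log_prod fun i _ ↦ (hq i).ne']
  rw [Finset.sum_add_distrib, Finset.sum_const, Finset.card_univ, nsmul_one] at hlog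
  have hsplit : ∑ i, ∑ j, hρ.1.overlap hσ.1 i j *
      ((hρ.1.eigenvalues i + r) * (hσ.1.eigenvalues j + r)⁻¹ - 1 -
        Real.log (hρ.1.eigenvalues i + r) + Real.log (hσ.1.eigenvalues j + r)) =
      ∑ i, ∑ j, hρ.1.overlap hσ.1 i j *
        ((hρ.1.eigenvalues i + r) * (hσ.1.eigenvalues j + r)⁻¹) -
      ∑ i, ∑ j, hρ.1.overlap hσ.1 i j * (1 + Real.log (hρ.1.eigenvalues i + r) -
        Real.log (hσ.1.eigenvalues j + r)) := by
    simp only [← Finset.sum_sub_distrib]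
    refine Finset.sum_congr rfl fun i _ ↦ Finset.sum_congr rfl fun j _ ↦ ?_
    ring
  rw [hsplit, hlog]
  ring

lemma hasDerivAt_shiftedRelEnt (hρ : ρ.PosSemidef) (hσ : σ.PosDef) {r : ℝ} (hr : 0 < r) :
    HasDerivAt (shiftedRelEnt hρ.1 hσ.1) (-logDetDiv (ρ + r • 1) (σ + r • 1)) r := by
  have hp (i : Fin d) : 0 < hρ.1.eigenvalues i + r :=
    add_pos_of_nonneg_of_pos (hρ.eigenvalues_nonneg i) hr
  have hq (j : Fin d) : 0 < hσ.1.eigenvalues j + r := add_pos (hσ.eigenvalues_pos j) hr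
  rw [logDetDiv_add_smul_one hρ hσ hr, ← Finset.sum_neg_distrib]
  simp only [← Finset.sum_neg_distrib]
  refine HasDerivAt.fun_sum fun i _ ↦ HasDerivAt.fun_sum fun j _ ↦ ?_
  have h1 : HasDerivAt (fun r ↦ hρ.1.eigenvalues i + r) 1 r := (hasDerivAt_id r).const_add _
  have h2 : HasDerivAt (fun r ↦ hσ.1.eigenvalues j + r) 1 r := (hasDerivAt_id r).const_add _
  have h3 := (h1.mul ((h1.log (hp i).ne').sub (h2.log (hq j).ne'))).const_mul
    (hρ.1.overlap hσ.1 i j)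
  refine h3.congr_deriv ?_
  have hp' := (hp i).ne'
  have hq' := (hq j).ne'
  simp only [Pi.sub_apply]
  field_simp
  ring

lemma nonneg_of_hasDerivAt_nonpos_of_tendsto {G G' : ℝ → ℝ} (hc : ContinuousOn G (Set.Ici 0))
    (hd : ∀ r, 0 < r → HasDerivAt G (G' r) r) (hG' : ∀ r, 0 < r → G' r ≤ 0)
    (ht : Filter.Tendsto G Filter.atTop (nhds 0)) : 0 ≤ G 0 := by
  have hanti : AntitoneOn G (Set.Ici 0) := by
    refine antitoneOn_of_deriv_nonpos (convex_Ici 0) hc ?_ ?_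
    · rw [interior_Ici]
      exact fun r hr ↦ (hd r hr).differentiableAt.differentiableWithinAt
    · rw [interior_Ici]
      intro r hr
      rw [(hd r hr).deriv]
      exact hG' r hr
  refine le_of_tendsto ht ?_
  filter_upwards [Filter.eventually_ge_atTop 0] with r hr
  exact hanti Set.self_mem_Ici hr hr

lemma posDef_smul_one {r : ℝ} (hr : 0 < r) : (r • (1 : Matrix (Fin d) (Fin d) ℂ)).PosDef :=
  PosDef.one.smul hr

lemma relEnt_nonneg (hρ : ρ.PosSemidef) (hσ : σ.PosDef) (h : ρ.trace = σ.trace) :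
    0 ≤ relEnt ρ σ := by
  rw [← shiftedRelEnt_zero hρ.1 hσ.1]
  refine nonneg_of_hasDerivAt_nonpos_of_tendsto (continuousOn_shiftedRelEnt hρ.1 hσ)
    (fun r hr ↦ hasDerivAt_shiftedRelEnt hρ hσ hr) (fun r hr ↦ ?_)
    (tendsto_shiftedRelEnt hρ.1 hσ.1 h)
  rw [neg_nonpos]
  exact logDetDiv_nonneg (PosDef.posSemidef_add hρ (posDef_smul_one hr))
    (hσ.add (posDef_smul_one hr))

end relEnt

section scalar

open Real

lemma sq_log_one_add_le {x : ℝ} (hx : 0 ≤ x) : log (1 + x) ^ 2 ≤ 2 * (x - log (1 + x)) := by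
  have h := Real.quadratic_le_exp_of_nonneg (Real.log_nonneg (by linarith : 1 ≤ 1 + x))
  rw [Real.exp_log (by linarith)] at h
  linarith

lemma sq_le_two_mul_sub_log_one_add {x : ℝ} (hx : -1 < x) (hx0 : x ≤ 0) :
    x ^ 2 ≤ 2 * (x - log (1 + x)) := by
  have h := Real.hasSum_pow_div_log_of_abs_lt_one (x := -x)
    (by rw [abs_of_nonneg (by linarith)]; linarith)
  have h2 := sum_le_hasSum (Finset.range 2) (fun i _ ↦ by
    have : 0 ≤ -x := by linarith
    positivity) h
  rw [Finset.sum_range_succ, Finset.sum_range_one, sub_neg_eq_add] at h2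
  norm_num at h2
  linarith

lemma mul_log_one_add_le {t x : ℝ} (ht0 : 0 ≤ t) (ht1 : t ≤ 1) (hx : -1 < x) :
    t * log (1 + x) ≤ log (1 + t * x) := by
  have h := strictConcaveOn_log_Ioi.concaveOn.2 (Set.mem_Ioi.2 one_pos)
    (Set.mem_Ioi.2 (by linarith : 0 < 1 + x)) (sub_nonneg.2 ht1) ht0 (by ring)
  simp only [smul_eq_mul, log_one, mul_zero, zero_add, mul_one] at h
  have h2 : 1 - t + t * (1 + x) = 1 + t * x := by ring
  rwa [h2] at h

lemma div_log_one_add_le {u : ℝ} (hu : 0 < u) :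
    u / log (1 + u) ≤ u ^ 2 / ((1 + u) * (log (1 + u) - 1) + 1) := by
  have hL : 0 < log (1 + u) := log_pos (by linarith)
  have hLu : log (1 + u) ≤ u := by
    have := log_le_sub_one_of_pos (by linarith : 0 < 1 + u)
    linarith
  have h1 : 0 < (1 + u) * (log (1 + u) - 1) + 1 := by
    have h := log_lt_sub_one_of_pos (inv_pos.2 (by linarith : 0 < 1 + u))
      (inv_ne_one.2 (by linarith))
    rw [log_inv] at h
    have h3 := mul_lt_mul_of_pos_left h (by linarith : 0 < 1 + u)
    rw [mul_sub, mul_inv_cancel₀ (by linarith)] at h3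
    linarith
  rw [div_le_div_iff₀ hL h1]
  nlinarith

/-- The scalar inequality behind the comparison of log-determinant divergences, in the variables
`u = c - 1` and `v = ν - 1`. -/
lemma weighted_log_comparison_nonneg {ζ u v : ℝ} (hζ0 : 0 < ζ) (hζ1 : ζ < 1) (hu : 0 ≤ u)
    (hv : -1 < v) (hvu : v ≤ u) :
    0 ≤ ζ * (u + 2 * (1 + ζ * u)) *
          log (((1 + ζ * (u + 2 * (1 + ζ * u))) / (1 + ζ * v) - 1) / (ζ * (u + 2 * (1 + ζ * u)))) +
        (1 + ζ * (u + 2 * (1 + ζ * u))) * log (1 + ζ * v) +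
        3 * ζ * (2 + ζ) * (1 + u ^ 2 / ((1 + u) * (log (1 + u) - 1) + 1)) *
          (v - log (1 + v)) := by
  have hζu : 0 ≤ ζ * u := by positivity
  set X := u ^ 2 / ((1 + u) * (log (1 + u) - 1) + 1) with hX
  set e := u - v + 2 * (1 + ζ * u) with he
  set w := v - log (1 + v) with hw
  have he2 : 2 ≤ e := by linarith
  have hs : 2 ≤ e + v := by linarith
  have hm : 0 < 1 + ζ * v := by nlinarith
  have hw0 : 0 ≤ w := by
    have := log_le_sub_one_of_pos (by linarith : 0 < 1 + v)
    linarith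
  have hk : u + 2 * (1 + ζ * u) = e + v := by rw [he]; ring
  rw [hk]
  set T := log ((e + v) / e) with hT
  have hlog : log (((1 + ζ * (e + v)) / (1 + ζ * v) - 1) / (ζ * (e + v))) =
      -T - log (1 + ζ * v) := by
    have : ((1 + ζ * (e + v)) / (1 + ζ * v) - 1) / (ζ * (e + v)) =
        ((e + v) / e)⁻¹ * (1 + ζ * v)⁻¹ := by
      have : e ≠ 0 := by linarith
      have : e + v ≠ 0 := by linarith
      field_simp
      ring
    have h1 : 0 < (e + v) / e := by apply div_pos <;> linarith
    rw [this, log_mul (inv_pos.2 h1).ne' (inv_pos.2 hm).ne', log_inv, log_inv]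
    ring
  rw [hlog]
  have heT : e * T ≤ v := by
    have h1 := log_le_sub_one_of_pos (by apply div_pos <;> linarith : 0 < (e + v) / e)
    have h2 := mul_le_mul_of_nonneg_left h1 (by linarith : 0 ≤ e)
    have h3 : e * ((e + v) / e - 1) = v := by
      have : e ≠ 0 := by linarith
      field_simp
      ring
    linarith
  have hconc := mul_log_one_add_le hζ0.le hζ1.le hv
  have hX0 : 0 ≤ X := by
    rcases hu.eq_or_lt with rfl | hu
    · simp [hX]
    · have : 0 < log (1 + u) := log_pos (by linarith)
      exact le_trans (by positivity) (div_log_one_add_le hu)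
  have hvT : v * T ≤ 5 * w + 6 * X * w := by
    rcases le_or_gt v 0 with hv0 | hv0
    · have h1 := sq_le_two_mul_sub_log_one_add hv hv0
      have h2 := one_sub_inv_le_log_of_pos (by apply div_pos <;> linarith : 0 < (e + v) / e)
      have h3 : 1 - ((e + v) / e)⁻¹ = v / (e + v) := by
        have : e ≠ 0 := by linarith
        have : e + v ≠ 0 := by linarith
        field_simp
        ring
      rw [h3] at h2
      have h4 : v * T ≤ v * (v / (e + v)) := mul_le_mul_of_nonpos_left h2 hv0
      have h5 : v * (v / (e + v)) ≤ v ^ 2 / 2 := by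
        rw [← mul_div_assoc, ← sq]
        exact div_le_div_of_nonneg_left (sq_nonneg v) two_pos hs
      have : 0 ≤ X * w := by positivity
      linarith
    · have hu0 : 0 < u := by linarith
      have hl : 0 < log (1 + v) := log_pos (by linarith)
      have hL : 0 < log (1 + u) := log_pos (by linarith)
      have hTl : T ≤ log (1 + v) := by
        apply log_le_log (by apply div_pos <;> linarith)
        rw [div_le_iff₀ (by linarith)]
        nlinarith
      have h1 := sq_log_one_add_le hv0.le
      have h2 := mul_log_one_add_le (t := v / u) (x := u) (by positivity)
        ((div_le_one hu0).2 hvu) (by linarith)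
      rw [div_mul_cancel₀ _ hu0.ne', div_mul_eq_mul_div, div_le_iff₀ hu0] at h2
      have h3 : v / log (1 + v) ≤ X := by
        refine le_trans ?_ (div_log_one_add_le hu0)
        rw [div_le_div_iff₀ hl hL]
        linarith
      have h4 : v * log (1 + v) ≤ 2 * (X * w) := by
        calc v * log (1 + v) = v / log (1 + v) * log (1 + v) ^ 2 := by field_simp
          _ ≤ v / log (1 + v) * (2 * w) := by gcongr
          _ ≤ X * (2 * w) := by gcongr
          _ = 2 * (X * w) := by ring
      have h5 : v * T ≤ v * log (1 + v) := by gcongr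
      have : 0 ≤ X * w := by positivity
      linarith
  have hC : 6 * ζ * (1 + X) * w ≤ 3 * ζ * (2 + ζ) * (1 + X) * w := by
    have : 0 ≤ ζ ^ 2 * (1 + X) * w := by positivity
    linarith
  have h1 := mul_le_mul_of_nonneg_left heT hζ0.le
  have h2 := mul_le_mul_of_nonneg_left hvT hζ0.le
  have h3 : ζ * log (1 + v) = ζ * v - ζ * w := by rw [hw]; ring
  linarith

end scalar

/-- **Theorem 1.4 (second inequality).** Triangle-like relative entropy comparison, with the
correction term measured by `D(η‖σ)`.  (In Lean, `(c-1)^2 / (c*(log c - 1) + 1)` automatically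
takes the value `0` when `c = 1`, since division by zero is zero.) -/
theorem triangle_like_relEnt_comparison_second
    (d : ℕ) (ρ σ ω : Matrix (Fin d) (Fin d) ℂ)
    (hρ : IsDensity ρ) (hσ : IsDensity σ) (hω : IsDensity ω)
    (hσpd : σ.PosDef)
    (ζ c : ℝ) (hζ : ζ ∈ Set.Ioo (0:ℝ) 1) (hc : 1 ≤ c)
    (h₁ : (ω - (1 - ζ) • σ).PosSemidef)
    (h₂ : ((1 + ζ * (c - 1)) • σ - ω).PosSemidef) :
    (1 - ζ) ^ 2 * relEnt ρ σ
      ≤ (1 + ζ * (c + 1) + 2 * ζ ^ 2 * (c - 1)) * relEnt ρ ω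
        + 3 * ζ * (2 + ζ) * (1 + (c - 1) ^ 2 / (c * (Real.log c - 1) + 1))
          * relEnt (ζ⁻¹ • (ω - (1 - ζ) • σ)) σ := by
  obtain ⟨hζ0, hζ1⟩ := hζ
  set η := ζ⁻¹ • (ω - (1 - ζ) • σ) with hη
  have hωη : ω = (1 - ζ) • σ + ζ • η := by
    rw [hη, smul_smul, mul_inv_cancel₀ hζ0.ne', one_smul]
    abel
  have hηpsd : η.PosSemidef := h₁.smul (inv_pos.2 hζ0).le
  have hηtr : η.trace = σ.trace := by
    rw [hη, trace_smul, trace_sub, trace_smul, hω.2, hσ.2, Complex.real_smul, Complex.real_smul]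
    have : (ζ : ℂ) ≠ 0 := by exact_mod_cast hζ0.ne'
    push_cast
    field_simp
    ring
  have hωpd : ω.PosDef := by
    rw [hωη]
    exact (hσpd.smul (sub_pos.2 hζ1)).add_posSemidef (hηpsd.smul hζ0.le)
  have hcη : (c • σ - η).PosSemidef := by
    have : c • σ - η = ζ⁻¹ • ((1 + ζ * (c - 1)) • σ - ω) := by
      rw [hη, ← sub_eq_zero]
      match_scalars <;> field_simp <;> ring
    rw [this]
    exact h₂.smul (inv_pos.2 hζ0).le
  set K := 1 + ζ * (c + 1) + 2 * ζ ^ 2 * (c - 1) with hK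
  set C := 3 * ζ * (2 + ζ) * (1 + (c - 1) ^ 2 / (c * (Real.log c - 1) + 1)) with hC
  have hK1 : 1 < K := by
    have : 0 ≤ 2 * ζ ^ 2 * (c - 1) := mul_nonneg (by positivity) (by linarith)
    have : 0 < ζ * (c + 1) := by positivity
    linarith
  have hdiv (r : ℝ) (hr : 0 < r) : logDetDiv (ρ + r • 1) (σ + r • 1) ≤
      K * logDetDiv (ρ + r • 1) (ω + r • 1) + C * logDetDiv (η + r • 1) (σ + r • 1) := by
    have hω' : ω + r • 1 = (1 - ζ) • (σ + r • 1) + ζ • (η + r • 1) := by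
      rw [hωη]
      module
    rw [hω']
    refine logDetDiv_le_of_forall_scalar (PosDef.posSemidef_add hρ.1 (posDef_smul_one hr))
      (hσpd.add (posDef_smul_one hr)) (PosDef.posSemidef_add hηpsd (posDef_smul_one hr))
      (c := c) ?_ hK1 (fun ν hν hνc ↦ ?_) (fun ν hν hνc ↦ ?_)
    · have : c • (σ + r • 1) - (η + r • 1) =
          (c • σ - η) + (c - 1) • (r • (1 : Matrix (Fin d) (Fin d) ℂ)) := by module
      rw [this]
      exact hcη.add ((posDef_smul_one hr).posSemidef.smul (sub_nonneg.2 hc))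
    · constructor
      · nlinarith
      · have : ζ * ν ≤ ζ * c := mul_le_mul_of_nonneg_left hνc hζ0.le
        have : 0 ≤ 2 * ζ ^ 2 * (c - 1) := mul_nonneg (by positivity) (by linarith)
        linarith
    · have h := weighted_log_comparison_nonneg hζ0 hζ1 (sub_nonneg.2 hc) (v := ν - 1) (by linarith)
        (by linarith)
      convert h using 1
      rw [hK, hC]
      ring_nf
  have hmain : 0 ≤ K * relEnt ρ ω + C * relEnt η σ - relEnt ρ σ := by
    rw [← shiftedRelEnt_zero hρ.1.1 hωpd.1, ← shiftedRelEnt_zero hηpsd.1 hσpd.1,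
      ← shiftedRelEnt_zero hρ.1.1 hσpd.1]
    have ht := (((tendsto_shiftedRelEnt hρ.1.1 hωpd.1 (hρ.2.trans hω.2.symm)).const_mul K).add
      ((tendsto_shiftedRelEnt hηpsd.1 hσpd.1 hηtr).const_mul C)).sub
      (tendsto_shiftedRelEnt hρ.1.1 hσpd.1 (hρ.2.trans hσ.2.symm))
    rw [mul_zero, mul_zero, add_zero, sub_zero] at ht
    refine nonneg_of_hasDerivAt_nonpos_of_tendsto (G := fun r ↦ K * shiftedRelEnt hρ.1.1 hωpd.1 r +
      C * shiftedRelEnt hηpsd.1 hσpd.1 r - shiftedRelEnt hρ.1.1 hσpd.1 r)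
      (((continuousOn_const.mul (continuousOn_shiftedRelEnt hρ.1.1 hωpd)).add
        (continuousOn_const.mul (continuousOn_shiftedRelEnt hηpsd.1 hσpd))).sub
        (continuousOn_shiftedRelEnt hρ.1.1 hσpd))
      (fun r hr ↦ (((hasDerivAt_shiftedRelEnt hρ.1 hωpd hr).const_mul K).add
        ((hasDerivAt_shiftedRelEnt hηpsd hσpd hr).const_mul C)).sub
        (hasDerivAt_shiftedRelEnt hρ.1 hσpd hr)) (fun r hr ↦ ?_) ht
    linarith [hdiv r hr]
  have h0 := relEnt_nonneg hρ.1 hσpd (hρ.2.trans hσ.2.symm)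
  have h1 : (1 - ζ) ^ 2 * relEnt ρ σ ≤ relEnt ρ σ :=
    mul_le_of_le_one_left h0 (pow_le_one₀ (by linarith) (by linarith))
  linarith
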